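/- arXiv:2112.07046 — 2 statements merged into one kernel-verified Lean document; each statement's English description precedes it below -/
import Mathlib

section
/- Let S be a set of k prime numbers. Then for every real x ≥ 3 one has Θ(x, S) ≤ exp(2·k^{1/2}·log log x + 20·(log x/log* k)·log*(k·log* k/log x)). -/
/-- `log* t = max {log t, 1}`. -/
noncomputable def logast (t : ℝ) : ℝ := max (Real.log t) 1

/-- `Theta x S` counts the positive integers `n ≤ x` all of whose prime factors lie in `S`
(the `S`-units up to `x`). -/
noncomputable def Theta (x : ℝ) (S : Finset ℕ) : ℕ :=
  {n : ℕ | 0 < n ∧ (n : ℝ) ≤ x ∧ ∀ p : ℕ, p.Prime → p ∣ n → p ∈ S}.ncard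

/-- The completely multiplicative function `n ↦ n ^ s`. -/
noncomputable def natRpowHom (s : ℝ) : ℕ →* ℝ where
  toFun n := (n : ℝ) ^ s
  map_one' := by simp
  map_mul' m n := by
    push_cast
    exact Real.mul_rpow m.cast_nonneg n.cast_nonneg

lemma setOf_sunit_subset_Icc (x : ℝ) (S : Finset ℕ) :
    {n : ℕ | 0 < n ∧ (n : ℝ) ≤ x ∧ ∀ p : ℕ, p.Prime → p ∣ n → p ∈ S} ⊆
      ↑(Finset.Icc 1 ⌊x⌋₊) := by
  rintro n ⟨h0, hn, -⟩
  exact Finset.mem_coe.mpr (Finset.mem_Icc.mpr ⟨h0, Nat.le_floor hn⟩)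

lemma Theta_le_self {x : ℝ} (hx : 0 ≤ x) (S : Finset ℕ) : (Theta x S : ℝ) ≤ x := by
  have h : Theta x S ≤ ⌊x⌋₊ := by
    have := Set.ncard_le_ncard (setOf_sunit_subset_Icc x S) (Finset.finite_toSet _)
    rw [Set.ncard_coe_finset, Nat.card_Icc] at this
    simpa [Theta] using this
  exact (Nat.cast_le.mpr h).trans (Nat.floor_le hx)

/-- Rankin's bound for the number of `S`-units up to `x`. -/
lemma Theta_le_rpow_mul_prod {S : Finset ℕ} (hS : ∀ p ∈ S, p.Prime) {x σ : ℝ} (hx : 0 < x)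
    (hσ : 0 < σ) :
    (Theta x S : ℝ) ≤ x ^ σ * ∏ p ∈ S, (1 - (p : ℝ) ^ (-σ))⁻¹ := by
  set A := {n : ℕ | 0 < n ∧ (n : ℝ) ≤ x ∧ ∀ p : ℕ, p.Prime → p ∣ n → p ∈ S} with hA
  have hfin : A.Finite := (Finset.finite_toSet _).subset (setOf_sunit_subset_Icc x S)
  have hlt : ∀ {p : ℕ}, p.Prime → ‖natRpowHom (-σ) p‖ < 1 := by
    intro p hp
    have h1 : (1 : ℝ) < p := by exact_mod_cast hp.one_lt
    change ‖(p : ℝ) ^ (-σ)‖ < 1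
    rw [Real.norm_of_nonneg (by positivity)]
    exact Real.rpow_lt_one_of_one_lt_of_neg h1 (neg_neg_of_pos hσ)
  obtain ⟨-, hprod⟩ :=
    EulerProduct.summable_and_hasSum_factoredNumbers_prod_filter_prime_geometric
      (f := natRpowHom (-σ)) hlt S
  rw [Finset.filter_true_of_mem hS] at hprod
  have hmem : ∀ n ∈ hfin.toFinset, n ∈ Nat.factoredNumbers S := by
    intro n hn
    obtain ⟨h0, -, h⟩ := hfin.mem_toFinset.mp hn
    exact Nat.mem_factoredNumbers.mpr ⟨h0.ne', fun p hp =>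
      h p (Nat.prime_of_mem_primeFactorsList hp) (Nat.dvd_of_mem_primeFactorsList hp)⟩
  have hle : ∑ n ∈ hfin.toFinset, (n : ℝ) ^ (-σ) ≤ ∏ p ∈ S, (1 - (p : ℝ) ^ (-σ))⁻¹ := by
    have := sum_le_hasSum (hfin.toFinset.subtype (· ∈ Nat.factoredNumbers S))
      (fun n _ => by change (0 : ℝ) ≤ ((n : ℕ) : ℝ) ^ (-σ); positivity) hprod
    rwa [Finset.sum_subtype_of_mem (fun n => natRpowHom (-σ) n) hmem] at this
  have hcard : (Theta x S : ℝ) = ∑ n ∈ hfin.toFinset, (1 : ℝ) := by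
    rw [Theta, ← hA, Set.ncard_eq_toFinset_card A hfin]
    simp
  rw [hcard]
  refine le_trans ?_ (mul_le_mul_of_nonneg_left hle (Real.rpow_nonneg hx.le σ))
  rw [Finset.mul_sum]
  refine Finset.sum_le_sum fun n hn => ?_
  obtain ⟨h0, hnx, -⟩ := hfin.mem_toFinset.mp hn
  have h0' : (0 : ℝ) < n := by exact_mod_cast h0
  calc (1 : ℝ) = (n : ℝ) ^ σ * (n : ℝ) ^ (-σ) := by
        rw [← Real.rpow_add h0']; simp
    _ ≤ x ^ σ * (n : ℝ) ^ (-σ) := by gcongr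

lemma inv_one_sub_exp_neg_le {y : ℝ} (hy : 0 < y) : (1 - Real.exp (-y))⁻¹ ≤ 1 + 1 / y := by
  have h1 : Real.exp (-y) ≤ (1 + y)⁻¹ := by
    rw [Real.exp_neg]
    exact inv_anti₀ (by positivity) (by linarith [Real.add_one_le_exp y])
  have h2 : (0 : ℝ) < 1 - (1 + y)⁻¹ := by
    have : (1 + y)⁻¹ < 1 := inv_lt_one_of_one_lt₀ (by linarith)
    linarith
  calc (1 - Real.exp (-y))⁻¹ ≤ (1 - (1 + y)⁻¹)⁻¹ := inv_anti₀ h2 (by linarith)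
    _ = 1 + 1 / y := by
      rw [show 1 - (1 + y)⁻¹ = y / (1 + y) by field_simp; ring, inv_div]
      field_simp
      ring

lemma card_filter_sq_le_le_sqrt {S : Finset ℕ} (hS : ∀ p ∈ S, p.Prime) (k : ℕ) :
    ((S.filter fun p => p * p ≤ k).card : ℝ) ≤ Real.sqrt k := by
  have h : (S.filter fun p => p * p ≤ k).card ≤ Nat.sqrt k := by
    refine (Finset.card_le_card (t := Finset.Icc 1 (Nat.sqrt k)) fun p hp => ?_).trans (by simp)
    obtain ⟨hp, hpk⟩ := Finset.mem_filter.mp hp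
    exact Finset.mem_Icc.mpr ⟨(hS p hp).one_le, Nat.le_sqrt.mpr hpk⟩
  exact (Nat.cast_le.mpr h).trans Real.nat_sqrt_le_real_sqrt

/-- The Rankin bound with `σ = log (1 + k / m) / (log k / 2)`, where `m = 2 log x / log k`
bounds the number of prime factors exceeding `√k` of an integer up to `x`. -/
lemma Theta_le_exp_of_log_card_le {S : Finset ℕ} (hS : ∀ p ∈ S, p.Prime) {x : ℝ} (hx : 0 < x)
    (hk : 20 ≤ Real.log S.card) (hkx : Real.log S.card ≤ Real.log x) :
    (Theta x S : ℝ) ≤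
      Real.exp (2 * Real.sqrt S.card * Real.log (Real.log x) +
        2 * Real.log x / Real.log S.card *
          (1 + Real.log (1 + S.card * Real.log S.card / Real.log x / 2))) := by
  set L := Real.log x with hL
  set k : ℝ := (S.card : ℝ) with hkdef
  set l := Real.log k with hl
  have hl0 : 0 < l := by linarith
  have hL0 : 0 < L := by linarith
  have hk1 : 1 ≤ k := by
    by_contra! h
    have : l ≤ 0 := Real.log_nonpos (by positivity) h.le
    linarith
  have hk0 : 0 < k := by linarith
  set m := 2 * L / l with hm
  have hm0 : 0 < m := by positivity
  have hu : k * l / L / 2 = k / m := by rw [hm]; field_simp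
  rw [hu]
  set t := Real.log (1 + k / m) with ht
  have hkm : 0 < k / m := by positivity
  have ht0 : 0 < t := Real.log_pos (by linarith)
  have ht1 : k / (k + m) ≤ t := by
    have := Real.one_sub_inv_le_log_of_pos (show 0 < 1 + k / m by positivity)
    refine le_trans (le_of_eq ?_) this
    field_simp
    ring
  set σ := t / (l / 2) with hσdef
  have hσ : 0 < σ := by positivity
  have hpow : ∀ p ∈ S, (p : ℝ) ^ (-σ) = Real.exp (-(σ * Real.log p)) := by
    intro p hp
    rw [Real.rpow_def_of_pos (by exact_mod_cast (hS p hp).pos)]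
    congr 1; ring
  have hlog2 : ∀ p ∈ S, 1 / 2 ≤ Real.log p := by
    intro p hp
    have h2 : (2 : ℝ) ≤ p := by exact_mod_cast (hS p hp).two_le
    have := Real.log_le_log (by norm_num) h2
    linarith [Real.log_two_gt_d9]
  have hpos : ∀ p ∈ S, 0 ≤ (1 - (p : ℝ) ^ (-σ))⁻¹ := by
    intro p hp
    rw [hpow p hp, inv_nonneg, sub_nonneg, Real.exp_le_one_iff]
    have := mul_pos hσ (show 0 < Real.log p by linarith [hlog2 p hp])
    linarith
  have hsmall : ∀ p ∈ S, (1 - (p : ℝ) ^ (-σ))⁻¹ ≤ L ^ 2 := by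
    intro p hp
    have hy : σ / 2 ≤ σ * Real.log p := by nlinarith [hlog2 p hp]
    rw [hpow p hp]
    refine (inv_one_sub_exp_neg_le (by linarith)).trans ?_
    have h1 : 1 / (σ * Real.log p) ≤ 1 / (σ / 2) :=
      one_div_le_one_div_of_le (by linarith) hy
    have h2 : 1 / (σ / 2) = l / t := by rw [hσdef]; field_simp
    have h3 : l / t ≤ l / (k / (k + m)) :=
      div_le_div_of_nonneg_left hl0.le (by positivity) ht1
    have h4 : l / (k / (k + m)) = l + 2 * L / k := by rw [hm]; field_simp
    have h5 : 2 * L / k ≤ 2 * L := div_le_self (by linarith) hk1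
    nlinarith
  have hlarge : ∀ p ∈ S, ¬ p * p ≤ S.card → (1 - (p : ℝ) ^ (-σ))⁻¹ ≤ Real.exp (m / k) := by
    intro p hp hpk
    have hp0 : (0 : ℝ) < p := by exact_mod_cast (hS p hp).pos
    have hkp : k ≤ (p : ℝ) * p := by
      rw [hkdef]
      exact_mod_cast (not_le.mp hpk).le
    have hlp : l / 2 ≤ Real.log p := by
      have := Real.log_le_log hk0 hkp
      rw [Real.log_mul hp0.ne' hp0.ne'] at this
      linarith
    have hy : t ≤ σ * Real.log p := by
      calc t = σ * (l / 2) := by rw [hσdef]; field_simp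
        _ ≤ _ := by gcongr
    have h1 : Real.exp (-(σ * Real.log p)) ≤ m / (k + m) := by
      calc Real.exp (-(σ * Real.log p)) ≤ Real.exp (-t) := Real.exp_le_exp.mpr (by linarith)
        _ = m / (k + m) := by
          rw [Real.exp_neg, ht, Real.exp_log (by positivity)]
          field_simp
          ring
    have h2 : 1 - m / (k + m) = k / (k + m) := by field_simp; ring
    rw [hpow p hp]
    calc (1 - Real.exp (-(σ * Real.log p)))⁻¹ ≤ (k / (k + m))⁻¹ :=
          inv_anti₀ (by positivity) (by linarith)
      _ = m / k + 1 := by field_simp; ring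
      _ ≤ _ := Real.add_one_le_exp _
  have hprod1 : ∏ p ∈ S.filter (fun p => p * p ≤ S.card), (1 - (p : ℝ) ^ (-σ))⁻¹ ≤
      Real.exp (2 * Real.sqrt k * Real.log L) := by
    have hlogL : 0 ≤ Real.log L := Real.log_nonneg (by linarith)
    calc _ ≤ ∏ p ∈ S.filter (fun p => p * p ≤ S.card), L ^ 2 :=
          Finset.prod_le_prod (fun p hp => hpos p (Finset.mem_filter.mp hp).1)
            fun p hp => hsmall p (Finset.mem_filter.mp hp).1
      _ = Real.exp (2 * (S.filter fun p => p * p ≤ S.card).card * Real.log L) := by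
          rw [Finset.prod_const, ← Real.exp_log (pow_pos hL0 2), ← Real.exp_nat_mul, Real.log_pow]
          congr 1; push_cast; ring
      _ ≤ _ := by
          have := card_filter_sq_le_le_sqrt hS S.card
          gcongr
  have hprod2 : ∏ p ∈ S.filter (fun p => ¬ p * p ≤ S.card), (1 - (p : ℝ) ^ (-σ))⁻¹ ≤
      Real.exp m := by
    calc _ ≤ ∏ p ∈ S.filter (fun p => ¬ p * p ≤ S.card), Real.exp (m / k) :=
          Finset.prod_le_prod (fun p hp => hpos p (Finset.mem_filter.mp hp).1)
            fun p hp => hlarge p (Finset.mem_filter.mp hp).1 (Finset.mem_filter.mp hp).2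
      _ = Real.exp ((S.filter fun p => ¬ p * p ≤ S.card).card * (m / k)) := by
          rw [Finset.prod_const, ← Real.exp_nat_mul]
      _ ≤ Real.exp (k * (m / k)) := by
          have : ((S.filter fun p => ¬ p * p ≤ S.card).card : ℝ) ≤ k :=
            Nat.cast_le.mpr (Finset.card_filter_le _ _)
          gcongr
      _ = Real.exp m := by congr 1; field_simp
  have hxσ : x ^ σ = Real.exp (m * t) := by
    rw [Real.rpow_def_of_pos hx, ← hL, hσdef, hm]
    congr 1; field_simp
  calc (Theta x S : ℝ) ≤ x ^ σ * ∏ p ∈ S, (1 - (p : ℝ) ^ (-σ))⁻¹ :=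
        Theta_le_rpow_mul_prod hS hx hσ
    _ ≤ Real.exp (m * t) * (Real.exp (2 * Real.sqrt k * Real.log L) * Real.exp m) := by
        rw [hxσ, ← Finset.prod_filter_mul_prod_filter_not S (fun p => p * p ≤ S.card)]
        refine mul_le_mul_of_nonneg_left (mul_le_mul hprod1 hprod2 ?_ ?_) (Real.exp_pos _).le
        · exact Finset.prod_nonneg fun p hp => hpos p (Finset.mem_filter.mp hp).1
        · exact (Real.exp_pos _).le
    _ = _ := by
        rw [← Real.exp_add, ← Real.exp_add]
        congr 1; ring

lemma one_add_log_one_add_half_le {u : ℝ} (hu : 0 ≤ u) :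
    1 + Real.log (1 + u / 2) ≤ 2 * logast u := by
  have h1 : 1 ≤ logast u := le_max_right _ _
  rcases le_total u 2 with h | h
  · linarith [Real.log_le_sub_one_of_pos (show 0 < 1 + u / 2 by positivity)]
  · have h2 : Real.log (1 + u / 2) ≤ Real.log u := Real.log_le_log (by positivity) (by linarith)
    have h3 : Real.log u ≤ logast u := le_max_left _ _
    linarith

theorem S_unit_count_bound (S : Finset ℕ) (hS : ∀ p ∈ S, p.Prime)
    (x : ℝ) (hx : 3 ≤ x) :
    (Theta x S : ℝ) ≤
      Real.exp (2 * Real.sqrt S.card * Real.log (Real.log x) +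
        20 * (Real.log x / logast S.card) *
          logast (S.card * logast S.card / Real.log x)) := by
  have hx0 : 0 < x := by linarith
  have hL1 : 1 < Real.log x := by
    rw [Real.lt_log_iff_exp_lt hx0]
    linarith [Real.exp_one_lt_d9]
  have hloglog : 0 ≤ 2 * Real.sqrt S.card * Real.log (Real.log x) :=
    mul_nonneg (by positivity) (Real.log_nonneg hL1.le)
  have hlk : 1 ≤ logast S.card := le_max_right _ _
  have hlu : 1 ≤ logast (S.card * logast S.card / Real.log x) := le_max_right _ _
  have htriv : logast S.card ≤ 20 * logast (S.card * logast S.card / Real.log x) →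
      (Theta x S : ℝ) ≤
      Real.exp (2 * Real.sqrt S.card * Real.log (Real.log x) +
        20 * (Real.log x / logast S.card) *
          logast (S.card * logast S.card / Real.log x)) := by
    intro h
    refine (Theta_le_self hx0.le S).trans ?_
    conv_lhs => rw [← Real.exp_log hx0]
    refine Real.exp_le_exp.mpr ?_
    have : Real.log x / logast S.card * logast S.card = Real.log x := by field_simp
    have h' := mul_le_mul_of_nonneg_left h
      (show 0 ≤ Real.log x / logast S.card by positivity)
    linarith
  rcases le_or_gt (logast S.card) 20 with h20 | h20
  · exact htriv (by linarith)
  have hlog : logast S.card = Real.log S.card := by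
    refine max_eq_left ?_
    by_contra! h
    rw [logast, max_eq_right h.le] at h20
    norm_num at h20
  rcases lt_or_ge (Real.log x) (Real.log S.card) with hlt | hge
  · refine htriv ?_
    have hk0 : (0 : ℝ) < S.card := by
      refine lt_of_le_of_ne (by positivity) fun h => ?_
      rw [← h, Real.log_zero] at hlt
      linarith
    have h1 : (S.card : ℝ) ≤ S.card * logast S.card / Real.log x := by
      rw [le_div_iff₀ (by linarith), hlog]
      gcongr
    have h2 : logast S.card ≤ logast (S.card * logast S.card / Real.log x) :=
      max_le_max_right _ (Real.log_le_log hk0 h1)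
    linarith
  · refine (Theta_le_exp_of_log_card_le hS hx0 (by linarith) hge).trans (Real.exp_le_exp.mpr ?_)
    rw [hlog] at hlu hlk ⊢
    have hu := one_add_log_one_add_half_le
      (show 0 ≤ S.card * Real.log S.card / Real.log x by positivity)
    have hd : 0 ≤ Real.log x / Real.log S.card := by positivity
    rw [mul_div_assoc]
    nlinarith [mul_le_mul_of_nonneg_left hu hd, mul_le_mul_of_nonneg_left hlu hd]
end

section
/- Let q ≥ 2 and a be rational integers with a² < 4q, and let α be a root of x² − a·x + q. Then for every positive integer n one has |log|Φₙ(α)| − (1/2)·φ(n)·log q| ≤ 5. -/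
open Polynomial in
theorem sum_divisors_log_norm_cyclotomic_eval {α : ℂ} (hα : 1 < ‖α‖) {n : ℕ} (hn : 0 < n) :
    ∑ d ∈ n.divisors, (Real.log ‖(cyclotomic d ℂ).eval α‖ - (Nat.totient d : ℝ) * Real.log ‖α‖) =
      Real.log ‖1 - α⁻¹ ^ n‖ := by
  have h0 : α ≠ 0 := norm_pos_iff.mp (by linarith)
  have hpow : ∀ m : ℕ, 0 < m → α ^ m - 1 ≠ 0 := by
    intro m hm h
    have h1 : ‖α‖ ^ m = 1 := by rw [← norm_pow, sub_eq_zero.mp h, norm_one]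
    exact absurd h1 (one_lt_pow₀ hα hm.ne').ne'
  have hprod : ∏ d ∈ n.divisors, (cyclotomic d ℂ).eval α = α ^ n - 1 := by
    rw [← eval_prod, prod_cyclotomic_eq_X_pow_sub_one hn]
    simp
  have hne : ∀ d ∈ n.divisors, ‖(cyclotomic d ℂ).eval α‖ ≠ 0 := by
    intro d hd h
    apply hpow n hn
    rw [← hprod]
    exact Finset.prod_eq_zero hd (norm_eq_zero.mp h)
  have hfac : α ^ n - 1 = α ^ n * (1 - α⁻¹ ^ n) := by
    rw [mul_sub, ← mul_pow, mul_inv_cancel₀ h0]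
    simp
  have hne' : ‖1 - α⁻¹ ^ n‖ ≠ 0 := by
    intro h
    apply hpow n hn
    rw [hfac, norm_eq_zero.mp h, mul_zero]
  rw [Finset.sum_sub_distrib, ← Finset.sum_mul, ← Nat.cast_sum, Nat.sum_totient,
    ← Real.log_prod hne, ← norm_prod, hprod, hfac, norm_mul, norm_pow,
    Real.log_mul (pow_ne_zero _ (norm_ne_zero_iff.mpr h0)) hne', Real.log_pow]
  ring

theorem abs_log_norm_one_sub_le {z : ℂ} (hz : ‖z‖ ^ 2 ≤ 1 / 2) :
    |Real.log ‖1 - z‖| ≤ ‖z‖ + 2 * ‖z‖ ^ 2 := by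
  set t := ‖z‖ with ht
  have ht0 : 0 ≤ t := norm_nonneg z
  have ht1 : t < 1 := by nlinarith
  have hlow : 1 - t ≤ ‖1 - z‖ := by simpa using norm_sub_norm_le (1 : ℂ) z
  have hupp : ‖1 - z‖ ≤ 1 + t := by simpa using norm_sub_le (1 : ℂ) z
  have hfac : Real.log (1 - t) + Real.log (1 + t) = Real.log (1 - t ^ 2) := by
    rw [← Real.log_mul (by linarith) (by linarith)]
    ring_nf
  have hone : Real.log (1 + t) ≤ t := by
    linarith [Real.log_le_sub_one_of_pos (show 0 < 1 + t by linarith)]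
  have hsq : 1 - (1 - t ^ 2)⁻¹ ≤ Real.log (1 - t ^ 2) :=
    Real.one_sub_inv_le_log_of_pos (by linarith)
  have hinv : (1 - t ^ 2)⁻¹ ≤ 1 + 2 * t ^ 2 := by
    rw [inv_le_iff_one_le_mul₀ (by linarith)]
    nlinarith [sq_nonneg t]
  rw [abs_le]
  constructor
  · linarith [Real.log_le_log (by linarith) hlow]
  · linarith [Real.log_le_log (by linarith) hupp, sq_nonneg t]

/-- Partial sums of `r ^ d + 2 * r ^ (2 * d)` over positive `d`, for `r ≤ 1 / √2`. -/
theorem sum_pow_add_two_mul_sq_le {r : ℝ} (hr0 : 0 ≤ r) (hr : r ^ 2 ≤ 1 / 2) (s : Finset ℕ)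
    (hs : ∀ d ∈ s, 0 < d) : ∑ d ∈ s, (r ^ d + 2 * (r ^ d) ^ 2) ≤ 5 := by
  have geom : ∀ x : ℝ, 0 ≤ x → x < 1 → ∑ d ∈ s, x ^ d ≤ (1 - x)⁻¹ - 1 := by
    intro x hx0 hx1
    have h := (summable_geometric_of_lt_one hx0 hx1).sum_le_tsum (insert 0 s)
      (fun i _ ↦ pow_nonneg hx0 i)
    rw [Finset.sum_insert fun h0 ↦ (hs 0 h0).ne' rfl, tsum_geometric_of_lt_one hx0 hx1] at h
    linarith [pow_zero x]
  have hr1 : r ≤ 5 / 7 + 1 / 100 := by nlinarith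
  have h1 : (1 - r)⁻¹ ≤ 4 := by
    rw [inv_le_iff_one_le_mul₀ (by linarith)]
    linarith
  have h2 : (1 - r ^ 2)⁻¹ ≤ 2 := by
    rw [inv_le_iff_one_le_mul₀ (by linarith)]
    linarith
  have hsum : ∑ d ∈ s, (r ^ d + 2 * (r ^ d) ^ 2) = ∑ d ∈ s, r ^ d + 2 * ∑ d ∈ s, (r ^ 2) ^ d := by
    rw [Finset.sum_add_distrib, Finset.mul_sum]
    simp only [pow_right_comm]
  rw [hsum]
  linarith [geom r hr0 (by linarith), geom (r ^ 2) (sq_nonneg r) (by linarith)]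

open ArithmeticFunction in
theorem abs_log_norm_cyclotomic_eval_sub_le {α : ℂ} (hα : 2 ≤ ‖α‖ ^ 2) {n : ℕ} (hn : 0 < n) :
    |Real.log ‖(Polynomial.cyclotomic n ℂ).eval α‖ - (Nat.totient n : ℝ) * Real.log ‖α‖| ≤ 5 := by
  have hα1 : 1 < ‖α‖ := by nlinarith [norm_nonneg α]
  set r := ‖α⁻¹‖ with hr
  have hr0 : 0 ≤ r := norm_nonneg _
  have hr2 : r ^ 2 ≤ 1 / 2 := by
    rw [hr, norm_inv, inv_pow, one_div]
    exact inv_anti₀ two_pos hα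
  have hterm : ∀ d > 0, |Real.log ‖1 - α⁻¹ ^ d‖| ≤ r ^ d + 2 * (r ^ d) ^ 2 := by
    intro d hd
    have hd2 : ‖α⁻¹ ^ d‖ ^ 2 ≤ 1 / 2 := by
      rw [norm_pow, ← hr, pow_right_comm]
      exact (pow_le_of_le_one (sq_nonneg r) (by linarith) hd.ne').trans hr2
    simpa only [norm_pow, ← hr] using abs_log_norm_one_sub_le hd2
  rw [← sum_eq_iff_sum_mul_moebius_eq.mp
    (fun m hm ↦ sum_divisors_log_norm_cyclotomic_eval hα1 hm) n hn]
  calc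
    _ ≤ ∑ x ∈ n.divisorsAntidiagonal, |(moebius x.1 : ℝ) * Real.log ‖1 - α⁻¹ ^ x.2‖| :=
      Finset.abs_sum_le_sum_abs _ _
    _ ≤ ∑ x ∈ n.divisorsAntidiagonal, |Real.log ‖1 - α⁻¹ ^ x.2‖| := by
      refine Finset.sum_le_sum fun x _ ↦ ?_
      rw [abs_mul]
      exact mul_le_of_le_one_left (abs_nonneg _) (mod_cast abs_moebius_le_one)
    _ = ∑ d ∈ n.divisors, |Real.log ‖1 - α⁻¹ ^ d‖| :=
      Nat.sum_divisorsAntidiagonal' fun _ d ↦ |Real.log ‖1 - α⁻¹ ^ d‖|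
    _ ≤ ∑ d ∈ n.divisors, (r ^ d + 2 * (r ^ d) ^ 2) :=
      Finset.sum_le_sum fun d hd ↦ hterm d (Nat.pos_of_mem_divisors hd)
    _ ≤ 5 := sum_pow_add_two_mul_sq_le hr0 hr2 _ fun _ hd ↦ Nat.pos_of_mem_divisors hd

theorem sq_norm_eq_of_quadratic_root {q a : ℝ} (ha : a ^ 2 < 4 * q) {α : ℂ}
    (hα : α ^ 2 - (a : ℂ) * α + (q : ℂ) = 0) : ‖α‖ ^ 2 = q := by
  have hre := congrArg Complex.re hα
  have him := congrArg Complex.im hα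
  simp only [pow_two, Complex.add_re, Complex.sub_re, Complex.mul_re, Complex.ofReal_re,
    Complex.ofReal_im, Complex.zero_re, Complex.add_im, Complex.sub_im, Complex.mul_im,
    Complex.zero_im] at hre him
  have hy : α.im ≠ 0 := by
    intro h
    rw [h] at hre
    nlinarith [sq_nonneg (2 * α.re - a)]
  have hx : 2 * α.re = a := mul_right_cancel₀ hy (by linarith)
  rw [← Complex.normSq_eq_norm_sq, Complex.normSq_apply]
  rw [← hx] at hre
  linarith

theorem log_cyclotomic_eval_estimate (q a : ℤ) (hq : 2 ≤ q) (ha : a ^ 2 < 4 * q)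
    (α : ℂ) (hα : α ^ 2 - (a : ℂ) * α + (q : ℂ) = 0) (n : ℕ) (hn : 0 < n) :
    |Real.log ‖(Polynomial.cyclotomic n ℂ).eval α‖ -
        1 / 2 * (Nat.totient n : ℝ) * Real.log q| ≤ 5 := by
  have hnorm : ‖α‖ ^ 2 = (q : ℝ) :=
    sq_norm_eq_of_quadratic_root (q := q) (a := a) (mod_cast ha) (mod_cast hα)
  have hlog : 1 / 2 * (Nat.totient n : ℝ) * Real.log q =
      (Nat.totient n : ℝ) * Real.log ‖α‖ := by
    rw [← hnorm, Real.log_pow]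
    push_cast
    ring
  rw [hlog]
  exact abs_log_norm_cyclotomic_eval_sub_le (hnorm ▸ mod_cast hq) hn
end
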